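/- Let S be a nonempty semigroup such that S \ E(S) is finite, and let T be an S-valued sequence of length |S \ E(S)| with Π(T) ∩ E(S) = ∅. Then for any two distinct elements a, b ∈ supp(T) and any positive integers k, t, if a^k = b^t then a^k is an idempotent; equivalently, the sets of non-idempotent elements of the cyclic subsemigroups ⟨a⟩ and ⟨b⟩ are disjoint. -/

import Mathlib

/-- Product, in order, of the nonempty list `a :: l` in a semigroup. -/
def sprod {S : Type*} [Mul S] (a : S) (l : List S) : S := l.foldl (· * ·) a

/-- `pow1 x n = x^(n+1)`: the `(n+1)`-st power of `x` in a semigroup. -/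
def pow1 {S : Type*} [Mul S] (x : S) : ℕ → S := fun n => Nat.rec x (fun _ y => y * x) n

/-- `Π(T)`: the set of products, in order, of nonempty lists which are
permutations of order-preserving sublists of `T`. -/
def PiSet {S : Type*} [Mul S] (T : List S) : Set S :=
  {s | ∃ u : List S, u.Sublist T ∧ ∃ a l, (a :: l).Perm u ∧ sprod a l = s}

/-- `A(L)`: the set of products, in order, of nonempty order-preserving sublists of `L`. -/
def ASet {S : Type*} [Mul S] (L : List S) : Set S :=
  {s | ∃ a l, (a :: l).Sublist L ∧ sprod a l = s}

/-- `HasIndexPeriod x r p` says that `r` is the index of `x` (the least `r > 0` such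
that `x^r = x^t` for some positive `t ≠ r`) and `p` is the period of `x` (the least
`p > 0` with `x^(r+p) = x^r`). Powers are expressed via `pow1 x (n-1) = x^n`. -/
def HasIndexPeriod {S : Type*} [Mul S] (x : S) (r p : ℕ) : Prop :=
  (0 < r ∧ (∃ t, 0 < t ∧ t ≠ r ∧ pow1 x (t - 1) = pow1 x (r - 1)) ∧
    ∀ r', 0 < r' → (∃ t, 0 < t ∧ t ≠ r' ∧ pow1 x (t - 1) = pow1 x (r' - 1)) → r ≤ r') ∧
  (0 < p ∧ pow1 x (r + p - 1) = pow1 x (r - 1) ∧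
    ∀ p', 0 < p' → pow1 x (r + p' - 1) = pow1 x (r - 1) → p ≤ p')

theorem pow1_succ {S : Type*} [Mul S] (x : S) (n : ℕ) : pow1 x (n + 1) = pow1 x n * x := rfl

theorem pow1_mul_pow1 {S : Type*} [Semigroup S] (x : S) (i j : ℕ) :
    pow1 x i * pow1 x j = pow1 x (i + j + 1) := by
  induction j with
  | zero => rfl
  | succ j ih => rw [pow1_succ, ← mul_assoc, ih, ← pow1_succ, ← add_assoc]

theorem pow1_mul_comm {S : Type*} [Semigroup S] (x : S) (n : ℕ) :
    pow1 x n * x = x * pow1 x n := by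
  induction n with
  | zero => rfl
  | succ n ih => rw [pow1_succ, ← mul_assoc, ← ih]

/-- An element with finitely many powers has an idempotent power. -/
theorem exists_pow1_idempotent {S : Type*} [Semigroup S] (x : S)
    (h : (Set.range (pow1 x)).Finite) : ∃ n, pow1 x n * pow1 x n = pow1 x n := by
  obtain ⟨i, j, hij, he⟩ : ∃ i j, i < j ∧ pow1 x i = pow1 x j := by
    by_contra! hne
    refine Set.infinite_range_of_injective (fun i j hij => ?_) h
    rcases lt_trichotomy i j with hlt | heq | hlt
    · exact (hne i j hlt hij).elim
    · exact heq
    · exact (hne j i hlt hij.symm).elim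
  obtain ⟨p, rfl⟩ := Nat.exists_eq_add_of_lt hij
  have shift (m : ℕ) : pow1 x (i + m + (p + 1)) = pow1 x (i + m) := by
    induction m with
    | zero => simpa [add_assoc] using he.symm
    | succ m ih =>
      rw [show i + (m + 1) + (p + 1) = i + m + (p + 1) + 1 by omega, pow1_succ, ih,
        ← pow1_succ, add_assoc]
  have shift_mul (m k : ℕ) : pow1 x (i + m + k * (p + 1)) = pow1 x (i + m) := by
    induction k with
    | zero => simp
    | succ k ih =>
      rw [show i + m + (k + 1) * (p + 1) = i + (m + k * (p + 1)) + (p + 1) by ring, shift,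
        ← add_assoc, ih]
  refine ⟨i + (i + 1) * p, ?_⟩
  rw [pow1_mul_pow1]
  convert shift_mul ((i + 1) * p) (i + 1) using 2
  ring

theorem ASet_mono {S : Type*} [Mul S] {L M : List S} (h : L.Sublist M) : ASet L ⊆ ASet M := by
  rintro _ ⟨a, l, hl, rfl⟩
  exact ⟨a, l, hl.trans h, rfl⟩

theorem mul_mem_ASet_append {S : Type*} [Mul S] {L : List S} {s : S} (hs : s ∈ ASet L) (x : S) :
    s * x ∈ ASet (L ++ [x]) := by
  obtain ⟨a, l, hl, rfl⟩ := hs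
  exact ⟨a, l ++ [x], hl.append_right [x], by simp [sprod]⟩

theorem mem_ASet_append_singleton {S : Type*} [Mul S] (L : List S) (x : S) :
    x ∈ ASet (L ++ [x]) :=
  ⟨x, [], List.sublist_append_right L [x], rfl⟩

theorem ASet_subset_PiSet {S : Type*} [Mul S] {L T : List S} (h : L.Perm T) :
    ASet L ⊆ PiSet T := by
  rintro _ ⟨a, l, hl, rfl⟩
  obtain ⟨u, hu, hT⟩ := hl.subperm.trans h.subperm
  exact ⟨u, hT, a, l, hu.symm, rfl⟩

theorem ASet_ssubset_append {S : Type*} [Semigroup S] {L : List S} {x : S}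
    (hfin : {x : S | x * x ≠ x}.Finite) (hsub : ASet (L ++ [x]) ⊆ {x : S | x * x ≠ x}) :
    ASet L ⊂ ASet (L ++ [x]) := by
  refine (ASet_mono (List.sublist_append_left L [x])).ssubset_of_ne fun heq => ?_
  have hpow (n : ℕ) : pow1 x n ∈ ASet L := by
    induction n with
    | zero => exact heq ▸ mem_ASet_append_singleton L x
    | succ n ih => rw [heq, pow1_succ]; exact mul_mem_ASet_append ih x
  have hmem (n : ℕ) : pow1 x n ∈ {x : S | x * x ≠ x} := hsub (heq ▸ hpow n)
  obtain ⟨n, hn⟩ :=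
    exists_pow1_idempotent x (hfin.subset (Set.range_subset_iff.2 hmem))
  exact hmem n hn

theorem ncard_ASet_add_length_le {S : Type*} [Semigroup S] (L M : List S)
    (hfin : {x : S | x * x ≠ x}.Finite) (hsub : ASet (L ++ M) ⊆ {x : S | x * x ≠ x}) :
    (ASet L).ncard + M.length ≤ (ASet (L ++ M)).ncard := by
  induction M generalizing L with
  | nil => simp
  | cons x M ih =>
    have happ : L ++ x :: M = (L ++ [x]) ++ M := by simp
    rw [happ] at hsub ⊢
    have hx := (ASet_mono (List.sublist_append_left (L ++ [x]) M)).trans hsub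
    have hlt := Set.ncard_lt_ncard (ASet_ssubset_append hfin hx) (hfin.subset hx)
    have hle := ih (L ++ [x]) hsub
    simp only [List.length_cons]
    omega

/-- The product of two distinct terms of an idempotent-product free sequence of maximal length
is one of the two terms. -/
theorem mul_eq_left_or_right {S : Type*} [Semigroup S] (hfin : {x : S | x * x ≠ x}.Finite)
    {T : List S} (hlen : T.length = {x : S | x * x ≠ x}.ncard)
    (hfree : PiSet T ∩ {e : S | e * e = e} = ∅) {a b : S} (ha : a ∈ T) (hb : b ∈ T)
    (hab : a ≠ b) : a * b = a ∨ a * b = b := by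
  classical
  by_contra! hne
  obtain ⟨M, hM⟩ : ∃ M, ([a, b] ++ M).Perm T := by
    refine ⟨(T.erase a).erase b, ?_⟩
    have hb' : b ∈ T.erase a := (List.mem_erase_of_ne hab.symm).2 hb
    exact (((List.perm_cons_erase ha).trans ((List.perm_cons_erase hb').cons a))).symm
  have hsub : ASet ([a, b] ++ M) ⊆ {x : S | x * x ≠ x} := fun x hx hxx =>
    (hfree ▸ ⟨ASet_subset_PiSet hM hx, hxx⟩ : x ∈ (∅ : Set S))
  have hfinA : (ASet [a, b]).Finite :=
    hfin.subset ((ASet_mono (List.sublist_append_left [a, b] M)).trans hsub)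
  have hthree : 3 ≤ (ASet [a, b]).ncard := by
    rw [← Set.ncard_eq_three.2 ⟨a, b, a * b, hab, hne.1.symm, hne.2.symm, rfl⟩]
    refine Set.ncard_le_ncard ?_ hfinA
    rintro y (rfl | rfl | rfl)
    · exact ⟨y, [], by simp, rfl⟩
    · exact ⟨y, [], by simp, rfl⟩
    · exact ⟨a, [b], by simp, rfl⟩
  have hle := ncard_ASet_add_length_le [a, b] M hfin hsub
  have hcard := Set.ncard_le_ncard hsub hfin
  have hMlen := hM.length_eq
  simp only [List.length_append, List.length_cons, List.length_nil] at hMlen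
  omega

theorem pow1_idempotent_of_mul_left {S : Type*} [Semigroup S] {x : S} {k : ℕ}
    (h : x * pow1 x k = x) : pow1 x k * pow1 x k = pow1 x k := by
  cases k with
  | zero => exact h
  | succ n =>
    calc pow1 x (n + 1) * pow1 x (n + 1) = pow1 x n * (x * pow1 x (n + 1)) := mul_assoc _ _ _
      _ = pow1 x (n + 1) := by rw [h, pow1_succ]

theorem mul_pow1_eq_self {S : Type*} [Semigroup S] {a b : S} (h : a * b = a) (t : ℕ) :
    a * pow1 b t = a := by
  induction t with
  | zero => exact h
  | succ t ih => rw [pow1_succ, ← mul_assoc, ih, h]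

theorem pow1_mul_eq_self {S : Type*} [Semigroup S] {a b : S} (h : a * b = b) (k : ℕ) :
    pow1 a k * b = b := by
  induction k with
  | zero => exact h
  | succ k ih => rw [pow1_succ, mul_assoc, h, ih]

/-- For an idempotent-product free sequence `T` of maximal length `|S \ E(S)|` and
distinct `a, b ∈ supp(T)`: whenever `a^(k+1) = b^(t+1)` this common value is an
idempotent; equivalently, the non-idempotent parts of `⟨a⟩` and `⟨b⟩` are disjoint. -/
theorem stmt_11 {S : Type*} [Semigroup S] [Nonempty S]
    (hfin : {x : S | x * x ≠ x}.Finite)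
    (T : List S) (hlen : T.length = {x : S | x * x ≠ x}.ncard)
    (hfree : PiSet T ∩ {e : S | e * e = e} = ∅) :
    ∀ a b : S, a ∈ T → b ∈ T → a ≠ b →
      (∀ k t : ℕ, pow1 a k = pow1 b t → pow1 a k * pow1 a k = pow1 a k) ∧
      ({y ∈ Set.range (pow1 a) | y * y ≠ y} ∩ {y ∈ Set.range (pow1 b) | y * y ≠ y}
        = ∅) := by
  intro a b ha hb hab
  have main (k t : ℕ) (h : pow1 a k = pow1 b t) : pow1 a k * pow1 a k = pow1 a k := by
    rcases mul_eq_left_or_right hfin hlen hfree ha hb hab with hmul | hmul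
    · exact pow1_idempotent_of_mul_left (h ▸ mul_pow1_eq_self hmul t)
    · have hbt : pow1 b t * b = b := h ▸ pow1_mul_eq_self hmul k
      rw [h]
      exact pow1_idempotent_of_mul_left (pow1_mul_comm b t ▸ hbt)
  refine ⟨main, Set.eq_empty_of_forall_notMem ?_⟩
  rintro _ ⟨⟨⟨k, rfl⟩, hk⟩, ⟨⟨t, ht⟩, -⟩⟩
  exact hk (main k t ht.symm)
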